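/- On a non-atomic probability space, an allocation (X₁,...,X_p) of a bounded real random variable X is Pareto efficient for the concave order if and only if it is comonotone, if and only if it minimizes E[Σᵢ ψᵢ(Yᵢ)] over allocations of X for some family of continuous strictly convex functions ψ₁,...,ψ_p : R → R. -/

import Mathlib

open MeasureTheory

/-- Comonotonicity of a pair of real random variables. -/
def Comonotone {Ω : Type*} [MeasurableSpace Ω] (μ : Measure Ω) (X Y : Ω → ℝ) : Prop :=
  ∀ᵐ q ∂(μ.prod μ), 0 ≤ (X q.1 - X q.2) * (Y q.1 - Y q.2)

/-- Concave-order dominance for real random variables: Y ⪰ X. -/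
def ConcaveDom {Ω : Type*} [MeasurableSpace Ω] (μ : Measure Ω) (Y X : Ω → ℝ) : Prop :=
  ∀ φ : ℝ → ℝ, ConvexOn ℝ Set.univ φ →
    ∫ ω, φ (Y ω) ∂μ ≤ ∫ ω, φ (X ω) ∂μ

/-- An allocation of X among p agents. -/
def IsAlloc {Ω : Type*} [MeasurableSpace Ω] {p : ℕ}
    (X : Ω → ℝ) (Y : Fin p → Ω → ℝ) : Prop :=
  (∀ i, Measurable (Y i)) ∧ (∀ i, ∃ C, ∀ ω, |Y i ω| ≤ C) ∧
    ∀ ω, ∑ i, Y i ω = X ω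

/-- Pareto efficiency for the concave order: no allocation of X strictly
dominates the given one componentwise. -/
def EfficientAlloc {Ω : Type*} [MeasurableSpace Ω] (μ : Measure Ω) {p : ℕ}
    (X : Ω → ℝ) (Xi : Fin p → Ω → ℝ) : Prop :=
  ¬ ∃ Y : Fin p → Ω → ℝ, IsAlloc X Y ∧
      (∀ i, ConcaveDom μ (Y i) (Xi i)) ∧
      ∃ i, ∃ φ : ℝ → ℝ, ConvexOn ℝ Set.univ φ ∧
        ∫ ω, φ (Y i ω) ∂μ < ∫ ω, φ (Xi i ω) ∂μ

/-- Non-atomicity of a probability space. -/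
def Nonatomic {Ω : Type*} [MeasurableSpace Ω] (μ : Measure Ω) : Prop :=
  ∀ s : Set Ω, MeasurableSet s → 0 < μ s →
    ∃ t : Set Ω, MeasurableSet t ∧ t ⊆ s ∧ 0 < μ t ∧ μ t < μ s

lemma aux_subgrad {φ : ℝ → ℝ} (hφ : ConvexOn ℝ Set.univ φ) :
    ∃ s : ℝ → ℝ, Monotone s ∧ ∀ y z, φ y + s y * (z - y) ≤ φ z := by
  refine ⟨fun x => derivWithin φ (Set.Ioi x) x, ?_, ?_⟩
  · have h := hφ.monotoneOn_rightDeriv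
    rw [interior_univ] at h
    exact monotoneOn_univ.1 h
  · intro y z
    rcases lt_trichotomy y z with h | h | h
    · have := hφ.rightDeriv_le_slope_of_mem_interior (x := y) (y := z) (by simp) (by simp) h
      rw [slope_def_field, le_div_iff₀ (by linarith)] at this
      linarith
    · subst h; simp
    · have h1 := hφ.slope_le_leftDeriv_of_mem_interior (x := z) (y := y) (by simp) (by simp) h
      have h2 := hφ.leftDeriv_le_rightDeriv_of_mem_interior (x := y) (by simp)
      have := h1.trans h2
      rw [slope_def_field, div_le_iff₀ (by linarith)] at this
      linarith

lemma aux_convex_of_subgrad {g h : ℝ → ℝ} (hg : ∀ y z, g y + h y * (z - y) ≤ g z) :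
    ConvexOn ℝ Set.univ g := by
  refine ⟨convex_univ, ?_⟩
  intro x _ y _ a b ha hb hab
  have h1 := mul_le_mul_of_nonneg_left (hg (a • x + b • y) x) ha
  have h2 := mul_le_mul_of_nonneg_left (hg (a • x + b • y) y) hb
  simp only [smul_eq_mul] at *
  obtain rfl : a = 1 - b := by linarith
  nlinarith

lemma aux_cont {φ : ℝ → ℝ} (hφ : ConvexOn ℝ Set.univ φ) : Continuous φ :=
  continuousOn_univ.1 (hφ.continuousOn isOpen_univ)

lemma aux_int {Ω : Type*} [MeasurableSpace Ω] (μ : Measure Ω) [IsProbabilityMeasure μ]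
    {φ : ℝ → ℝ} (hφ : Continuous φ) {W : Ω → ℝ} (hW : Measurable W)
    (hb : ∃ C, ∀ ω, |W ω| ≤ C) : Integrable (fun ω => φ (W ω)) μ := by
  obtain ⟨C, hC⟩ := hb
  obtain ⟨D, hD⟩ := (isCompact_Icc (a := -C) (b := C)).exists_bound_of_continuousOn
    hφ.continuousOn
  exact Integrable.of_bound (hφ.measurable.comp hW).aestronglyMeasurable D
    (.of_forall fun ω => hD _ (abs_le.1 (hC ω)))

lemma aux_supp {Ω : Type*} [MeasurableSpace Ω] (μ : Measure Ω) [IsProbabilityMeasure μ]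
    {U V : Ω → ℝ} (hU : Measurable U) (hV : Measurable V) :
    ∀ᵐ ω ∂μ, (U ω, V ω) ∈ (μ.map (fun ω => (U ω, V ω))).support :=
  ae_of_ae_map (hU.prodMk hV).aemeasurable
    (Measure.support_mem_ae (μ := μ.map (fun ω => (U ω, V ω))))

lemma aux_supp_pos {Ω : Type*} [MeasurableSpace Ω] (μ : Measure Ω) [IsProbabilityMeasure μ]
    {U V : Ω → ℝ} (hU : Measurable U) (hV : Measurable V) {x : ℝ × ℝ}
    (hx : x ∈ (μ.map (fun ω => (U ω, V ω))).support) {O : Set (ℝ × ℝ)} (hO : IsOpen O)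
    (hxO : x ∈ O) : 0 < μ ((fun ω => (U ω, V ω)) ⁻¹' O) := by
  have := (Measure.mem_support_iff_forall x).1 hx O (hO.mem_nhds hxO)
  rwa [Measure.map_apply (hU.prodMk hV) hO.measurableSet] at this

lemma aux_comon_of_supp {Ω : Type*} [MeasurableSpace Ω] (μ : Measure Ω) [IsProbabilityMeasure μ]
    {U V : Ω → ℝ} (hU : Measurable U) (hV : Measurable V)
    (h : ∀ x ∈ (μ.map (fun ω => (U ω, V ω))).support,
      ∀ y ∈ (μ.map (fun ω => (U ω, V ω))).support, 0 ≤ (x.1 - y.1) * (x.2 - y.2)) :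
    Comonotone μ U V := by
  have h1 := aux_supp μ hU hV
  have a1 := (Measure.quasiMeasurePreserving_fst (μ := μ) (ν := μ)).ae h1
  have a2 := (Measure.quasiMeasurePreserving_snd (μ := μ) (ν := μ)).ae h1
  unfold Comonotone
  filter_upwards [a1, a2] with q h1 h2
  exact h _ h1 _ h2

lemma aux_supp_of_comon {Ω : Type*} [MeasurableSpace Ω] (μ : Measure Ω) [IsProbabilityMeasure μ]
    {U V : Ω → ℝ} (hU : Measurable U) (hV : Measurable V) (h : Comonotone μ U V) :
    ∀ x ∈ (μ.map (fun ω => (U ω, V ω))).support,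
      ∀ y ∈ (μ.map (fun ω => (U ω, V ω))).support, 0 ≤ (x.1 - y.1) * (x.2 - y.2) := by
  intro x hx y hy
  by_contra! hlt
  have hopen : IsOpen {q : (ℝ × ℝ) × (ℝ × ℝ) | (q.1.1 - q.2.1) * (q.1.2 - q.2.2) < 0} :=
    isOpen_lt (by fun_prop) (by fun_prop)
  obtain ⟨O1, O2, ho1, ho2, hx1, hy2, hsub⟩ := isOpen_prod_iff.1 hopen x y hlt
  have p1 := aux_supp_pos μ hU hV hx ho1 hx1
  have p2 := aux_supp_pos μ hU hV hy ho2 hy2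
  have hpos : 0 < (μ.prod μ) (((fun ω => (U ω, V ω)) ⁻¹' O1) ×ˢ ((fun ω => (U ω, V ω)) ⁻¹' O2)) := by
    rw [Measure.prod_prod]
    exact ENNReal.mul_pos p1.ne' p2.ne'
  refine hpos.ne' (measure_mono_null ?_ (ae_iff.1 h))
  intro q hq
  have := hsub (Set.mk_mem_prod hq.1 hq.2)
  simpa using this

/-- A bounded monotone subset of the plane is contained in a convex subdifferential. -/
lemma aux_convex_exists {K : Set (ℝ × ℝ)} {C : ℝ} (hC : ∀ x ∈ K, |x.2| ≤ C)
    (hK : ∀ x ∈ K, ∀ y ∈ K, 0 ≤ (x.1 - y.1) * (x.2 - y.2)) :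
    ∃ g : ℝ → ℝ, ConvexOn ℝ Set.univ g ∧ ∀ x ∈ K, ∀ z, g x.1 + x.2 * (z - x.1) ≤ g z := by
  set S : ℝ → Set ℝ := fun t => insert (-C) {v | ∃ u, (u, v) ∈ K ∧ u ≤ t} with hS
  have hbd : ∀ t, BddAbove (S t) := fun t => ⟨max C (-C), by
    rintro v (rfl | ⟨u, hu, _⟩)
    · exact le_max_right _ _
    · exact (abs_le.1 (hC _ hu)).2.trans (le_max_left _ _)⟩
  set h : ℝ → ℝ := fun t => sSup (S t) with hh
  have hmono : Monotone h := by
    intro a b hab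
    refine csSup_le_csSup (hbd b) ⟨-C, Set.mem_insert _ _⟩ ?_
    rintro v (rfl | ⟨u, hu, hua⟩)
    · exact Set.mem_insert _ _
    · exact Or.inr ⟨u, hu, hua.trans hab⟩
  have key : ∀ (u v : ℝ), (∀ t, u < t → v ≤ h t) → (∀ t, t < u → h t ≤ v) → ∀ z,
      (∫ t in (0:ℝ)..u, h t) + v * (z - u) ≤ ∫ t in (0:ℝ)..z, h t := by
    intro u v h1 h2 z
    have hi : ∀ a b, IntervalIntegrable h volume a b := fun a b => hmono.intervalIntegrable
    have hadd := intervalIntegral.integral_add_adjacent_intervals (hi 0 u) (hi u z)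
    have hconst : ∀ a b, IntervalIntegrable (fun _ : ℝ => v) volume a b := fun a b => by simp
    rcases le_total u z with hz | hz
    · have := intervalIntegral.integral_mono_on_of_le_Ioo hz (hconst u z) (hi u z)
        (fun t ht => h1 t ht.1)
      rw [intervalIntegral.integral_const, smul_eq_mul] at this
      linarith
    · have := intervalIntegral.integral_mono_on_of_le_Ioo hz (hi z u) (hconst z u)
        (fun t ht => h2 t ht.2)
      rw [intervalIntegral.integral_const, smul_eq_mul,
        intervalIntegral.integral_symm] at this
      linarith
  refine ⟨fun y => ∫ t in (0:ℝ)..y, h t, ?_, ?_⟩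
  · exact aux_convex_of_subgrad (h := h) fun y z =>
      key y (h y) (fun t ht => hmono ht.le) (fun t ht => hmono ht.le) z
  · rintro ⟨u, v⟩ hx z
    refine key u v ?_ ?_ z
    · intro t ht
      exact le_csSup (hbd t) (Or.inr ⟨u, hx, ht.le⟩)
    · intro t ht
      refine csSup_le ⟨-C, Set.mem_insert _ _⟩ ?_
      rintro w (rfl | ⟨u', hu', hut⟩)
      · exact (abs_le.1 (hC _ hx)).1
      · have := hK _ hx _ hu'
        simp only at this
        have hp : 0 < u - u' := by linarith
        have := nonneg_of_mul_nonneg_right this hp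
        linarith

lemma aux_comon_sum {Ω : Type*} [MeasurableSpace Ω] (μ : Measure Ω) {ι : Type*} [Countable ι]
    (s : Finset ι) (U : Ω → ℝ) (V : ι → Ω → ℝ) (h : ∀ j, Comonotone μ U (V j)) :
    Comonotone μ U (fun ω => ∑ j ∈ s, V j ω) := by
  unfold Comonotone at *
  filter_upwards [ae_all_iff.2 h] with q hq
  rw [← Finset.sum_sub_distrib, Finset.mul_sum]
  exact Finset.sum_nonneg fun j _ => hq j

lemma aux_min_of_comon {Ω : Type*} [MeasurableSpace Ω] (μ : Measure Ω) [IsProbabilityMeasure μ]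
    {p : ℕ} (X : Ω → ℝ)
    (Xi : Fin p → Ω → ℝ) (hXi : IsAlloc X Xi) (hc : ∀ i j, Comonotone μ (Xi i) (Xi j)) :
      ∃ ψ : Fin p → ℝ → ℝ,
        (∀ i, Continuous (ψ i) ∧ StrictConvexOn ℝ Set.univ (ψ i)) ∧
        ∀ Y : Fin p → Ω → ℝ, IsAlloc X Y →
          ∫ ω, ∑ i, ψ i (Xi i ω) ∂μ ≤ ∫ ω, ∑ i, ψ i (Y i ω) ∂μ := by
  obtain ⟨hm, hb, hs⟩ := hXi
  choose C hC using hb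
  have hg : ∀ i, ∃ g : ℝ → ℝ, ConvexOn ℝ Set.univ g ∧ ∀ᵐ ω ∂μ, ∀ z,
      g (Xi i ω) + (X ω - Xi i ω) * (z - Xi i ω) ≤ g z := by
    intro i
    set V : Ω → ℝ := fun ω => ∑ j ∈ Finset.univ.erase i, Xi j ω with hV
    have hVm : Measurable V := Finset.measurable_sum _ fun j _ => hm j
    have hco : Comonotone μ (Xi i) V := aux_comon_sum μ _ _ _ (hc i)
    have hVX : ∀ ω, V ω = X ω - Xi i ω := fun ω => by
      rw [← hs ω, ← Finset.add_sum_erase _ _ (Finset.mem_univ i)]; simp [hV]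
    have hVb : ∀ ω, |V ω| ≤ ∑ j ∈ Finset.univ.erase i, C j := fun ω =>
      (Finset.abs_sum_le_sum_abs _ _).trans (Finset.sum_le_sum fun j _ => hC j ω)
    have hK := aux_supp_of_comon μ (hm i) hVm hco
    have hcl : IsClosed {x : ℝ × ℝ | |x.2| ≤ ∑ j ∈ Finset.univ.erase i, C j} :=
      isClosed_le (by fun_prop) (by fun_prop)
    have hKb : (μ.map (fun ω => (Xi i ω, V ω))).support ⊆
        {x : ℝ × ℝ | |x.2| ≤ ∑ j ∈ Finset.univ.erase i, C j} := by
      refine Measure.support_subset_of_isClosed hcl ?_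
      exact (ae_map_iff ((hm i).prodMk hVm).aemeasurable hcl.measurableSet).2 (.of_forall hVb)
    obtain ⟨g, hgc, hg⟩ := aux_convex_exists (fun x hx => hKb hx) hK
    refine ⟨g, hgc, ?_⟩
    filter_upwards [aux_supp μ (hm i) hVm] with ω hω z
    rw [← hVX]
    exact hg _ hω z
  choose g hgc hg using hg
  have hcont : ∀ i, Continuous (fun x : ℝ => g i x + x ^ 2 / 2) := fun i =>
    (aux_cont (hgc i)).add (by fun_prop)
  refine ⟨fun i x => g i x + x ^ 2 / 2, fun i => ⟨hcont i, ?_⟩, ?_⟩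
  · refine (hgc i).add_strictConvexOn ⟨convex_univ, ?_⟩
    intro x _ y _ hxy a b ha hb hab
    simp only [smul_eq_mul]
    obtain rfl : a = 1 - b := by linarith
    have : 0 < (1 - b) * b * (x - y) ^ 2 :=
      mul_pos (mul_pos ha hb) (by have := sub_ne_zero.2 hxy; positivity)
    nlinarith
  · intro Y hY
    obtain ⟨hYm, hYb, hYs⟩ := hY
    refine integral_mono_ae (integrable_finsetSum _ fun i _ => aux_int μ (hcont i) (hm i) ⟨C i, hC i⟩)
      (integrable_finsetSum _ fun i _ => aux_int μ (hcont i) (hYm i) (hYb i)) ?_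
    filter_upwards [ae_all_iff.2 hg] with ω hω
    have h1 : ∀ i, (g i (Xi i ω) + Xi i ω ^ 2 / 2) + X ω * (Y i ω - Xi i ω) ≤
        g i (Y i ω) + Y i ω ^ 2 / 2 := fun i => by
      have := hω i (Y i ω)
      nlinarith [sq_nonneg (Y i ω - Xi i ω)]
    have h2 := Finset.sum_le_sum (s := Finset.univ) fun i _ => h1 i
    rw [Finset.sum_add_distrib, ← Finset.mul_sum, Finset.sum_sub_distrib, hYs, hs] at h2
    simpa using h2

lemma aux_eff_of_min {Ω : Type*} [MeasurableSpace Ω] (μ : Measure Ω) [IsProbabilityMeasure μ]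
    {p : ℕ} (X : Ω → ℝ)
    (Xi : Fin p → Ω → ℝ) (hXi : IsAlloc X Xi) (ψ : Fin p → ℝ → ℝ)
    (hψ : ∀ i, Continuous (ψ i) ∧ StrictConvexOn ℝ Set.univ (ψ i))
    (hmin : ∀ Y : Fin p → Ω → ℝ, IsAlloc X Y →
          ∫ ω, ∑ i, ψ i (Xi i ω) ∂μ ≤ ∫ ω, ∑ i, ψ i (Y i ω) ∂μ) :
    EfficientAlloc μ X Xi := by
  rintro ⟨Y, hY, hdom, i₀, φ, hφ, hlt⟩
  have hZ : IsAlloc X (fun i ω => (1/2 : ℝ) * Xi i ω + (1/2 : ℝ) * Y i ω) := by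
    refine ⟨fun i => ((hXi.1 i).const_mul _).add ((hY.1 i).const_mul _), fun i => ?_, fun ω => ?_⟩
    · obtain ⟨C, hC⟩ := hXi.2.1 i
      obtain ⟨D, hD⟩ := hY.2.1 i
      refine ⟨C + D, fun ω => ?_⟩
      have h1 := abs_le.1 (hC ω)
      have h2 := abs_le.1 (hD ω)
      have h3 := (abs_nonneg _).trans (hC ω)
      have h4 := (abs_nonneg _).trans (hD ω)
      rw [abs_le]; constructor <;> linarith
    · rw [Finset.sum_add_distrib, ← Finset.mul_sum, ← Finset.mul_sum, hXi.2.2, hY.2.2]; ring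
  have iX : ∀ i, Integrable (fun ω => ψ i (Xi i ω)) μ := fun i =>
    aux_int μ (hψ i).1 (hXi.1 i) (hXi.2.1 i)
  have iY : ∀ i, Integrable (fun ω => ψ i (Y i ω)) μ := fun i =>
    aux_int μ (hψ i).1 (hY.1 i) (hY.2.1 i)
  have iZ : ∀ i, Integrable (fun ω => ψ i ((1/2 : ℝ) * Xi i ω + (1/2 : ℝ) * Y i ω)) μ := fun i =>
    aux_int μ (hψ i).1 (hZ.1 i) (hZ.2.1 i)
  have hle : ∀ i, ∫ ω, ψ i (Y i ω) ∂μ ≤ ∫ ω, ψ i (Xi i ω) ∂μ := fun i =>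
    hdom i (ψ i) (hψ i).2.convexOn
  have hm := hmin _ hZ
  rw [integral_finsetSum _ fun i _ => iX i, integral_finsetSum _ fun i _ => iZ i] at hm
  -- the midpoint defect
  set D : Fin p → Ω → ℝ := fun i ω => (1/2 : ℝ) * ψ i (Xi i ω) + (1/2 : ℝ) * ψ i (Y i ω)
    - ψ i ((1/2 : ℝ) * Xi i ω + (1/2 : ℝ) * Y i ω) with hD
  have iD : ∀ i, Integrable (D i) μ := fun i =>
    (((iX i).const_mul _).add ((iY i).const_mul _)).sub (iZ i)
  have D0 : ∀ i ω, 0 ≤ D i ω := fun i ω => by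
    have := (hψ i).2.convexOn.2 (Set.mem_univ (Xi i ω)) (Set.mem_univ (Y i ω))
      (show (0:ℝ) ≤ 1/2 by norm_num) (show (0:ℝ) ≤ 1/2 by norm_num) (by norm_num)
    simp only [smul_eq_mul] at this
    simp only [hD]; linarith
  have eD : ∀ i, ∫ ω, D i ω ∂μ = (1/2 : ℝ) * ∫ ω, ψ i (Xi i ω) ∂μ + (1/2 : ℝ) * ∫ ω, ψ i (Y i ω) ∂μ
      - ∫ ω, ψ i ((1/2 : ℝ) * Xi i ω + (1/2 : ℝ) * Y i ω) ∂μ := fun i => by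
    have iS : Integrable (fun ω => (1/2 : ℝ) * ψ i (Xi i ω) + (1/2 : ℝ) * ψ i (Y i ω)) μ :=
      ((iX i).const_mul _).add ((iY i).const_mul _)
    simp only [hD]
    rw [integral_sub iS (iZ i),
      integral_add ((iX i).const_mul _) ((iY i).const_mul _), integral_const_mul, integral_const_mul]
  have sD : ∑ i, ∫ ω, D i ω ∂μ ≤ 0 := by
    have : ∑ i, ∫ ω, D i ω ∂μ ≤ ∑ i, (∫ ω, ψ i (Xi i ω) ∂μ
      - ∫ ω, ψ i ((1/2 : ℝ) * Xi i ω + (1/2 : ℝ) * Y i ω) ∂μ) :=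
      Finset.sum_le_sum fun i _ => by rw [eD]; linarith [hle i]
    rw [Finset.sum_sub_distrib] at this
    linarith
  have nD : ∀ i, 0 ≤ ∫ ω, D i ω ∂μ := fun i => integral_nonneg (D0 i)
  have zD := (Finset.sum_eq_zero_iff_of_nonneg fun i _ => nD i).1
    (le_antisymm sD (Finset.sum_nonneg fun i _ => nD i)) i₀ (Finset.mem_univ _)
  have hae := (integral_eq_zero_iff_of_nonneg (D0 i₀) (iD i₀)).1 zD
  refine hlt.ne (integral_congr_ae ?_)
  filter_upwards [hae] with ω hω
  by_contra hne
  have hXY : Xi i₀ ω ≠ Y i₀ ω := fun h => hne (by rw [h])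
  have := (hψ i₀).2.2 (Set.mem_univ (Xi i₀ ω)) (Set.mem_univ (Y i₀ ω)) hXY
      (show (0:ℝ) < 1/2 by norm_num) (show (0:ℝ) < 1/2 by norm_num) (by norm_num)
  simp only [smul_eq_mul] at this
  simp only [hD, Pi.zero_apply] at hω
  linarith

/-- Mean-preserving transfers towards a level `a` improve in the concave order. -/
lemma aux_transfer {Ω : Type*} [MeasurableSpace Ω] (μ : Measure Ω) [IsProbabilityMeasure μ]
    {W W' : Ω → ℝ} (hW : Measurable W) (hWb : ∃ C, ∀ ω, |W ω| ≤ C)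
    (hW' : Measurable W') (hWb' : ∃ C, ∀ ω, |W' ω| ≤ C)
    (a : ℝ) (hmean : ∫ ω, W' ω ∂μ = ∫ ω, W ω ∂μ)
    (h : ∀ ω, (W' ω ≤ W ω ∧ a ≤ W' ω) ∨ (W ω ≤ W' ω ∧ W' ω ≤ a) ∨ W' ω = W ω) :
    ConcaveDom μ W' W := by
  intro φ hφ
  obtain ⟨s, hs, hsub⟩ := aux_subgrad hφ
  have i1 := aux_int μ (aux_cont hφ) hW hWb
  have i2 := aux_int μ (aux_cont hφ) hW' hWb'
  have i3 := aux_int μ continuous_id hW hWb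
  have i4 := aux_int μ continuous_id hW' hWb'
  simp only [id] at i3 i4
  have i5 : Integrable (fun ω => s a * (W ω - W' ω)) μ := (i3.sub i4).const_mul _
  have : ∫ ω, φ (W' ω) ∂μ ≤ ∫ ω, (φ (W ω) - s a * (W ω - W' ω)) ∂μ := by
    refine integral_mono i2 (i1.sub i5) fun ω => ?_
    have h1 := hsub (W' ω) (W ω)
    simp only
    rcases h ω with ⟨h2, h3⟩ | ⟨h2, h3⟩ | h2
    · nlinarith [hs h3]
    · nlinarith [hs h3]
    · simp [h2]
  rw [integral_sub i1 i5, integral_const_mul, integral_sub i3 i4, hmean] at this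
  linarith

lemma aux_comon_of_eff {Ω : Type*} [MeasurableSpace Ω] (μ : Measure Ω) [IsProbabilityMeasure μ]
    {p : ℕ} (X : Ω → ℝ)
    (Xi : Fin p → Ω → ℝ) (hXi : IsAlloc X Xi) (heff : EfficientAlloc μ X Xi) (i j : Fin p) :
    Comonotone μ (Xi i) (Xi j) := by
  by_cases hij : i = j
  · subst hij
    exact .of_forall fun q => mul_self_nonneg _
  have hmi := hXi.1 i
  have hmj := hXi.1 j
  refine aux_comon_of_supp μ hmi hmj ?_
  suffices H : ∀ x ∈ (μ.map (fun ω => (Xi i ω, Xi j ω))).support,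
      ∀ y ∈ (μ.map (fun ω => (Xi i ω, Xi j ω))).support, y.1 < x.1 → x.2 < y.2 → False by
    intro x hx y hy
    by_contra! hlt
    rcases mul_neg_iff.1 hlt with ⟨h1, h2⟩ | ⟨h1, h2⟩
    · exact H x hx y hy (by linarith) (by linarith)
    · exact H y hy x hx (by linarith) (by linarith)
  rintro ⟨u, v⟩ hx ⟨u', v'⟩ hy hu hv
  simp only at hu hv
  set ε : ℝ := min (u - u') (v' - v) / 4 with hε
  have hε0 : 0 < ε := by
    have : 0 < min (u - u') (v' - v) := lt_min (by linarith) (by linarith)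
    positivity
  have hε1 : 4 * ε ≤ u - u' := by rw [hε]; linarith [min_le_left (u - u') (v' - v)]
  have hε2 : 4 * ε ≤ v' - v := by rw [hε]; linarith [min_le_right (u - u') (v' - v)]
  set A : Set Ω := (fun ω => (Xi i ω, Xi j ω)) ⁻¹' (Set.Ioi (u - ε) ×ˢ Set.Iio (v + ε)) with hA
  set B : Set Ω := (fun ω => (Xi i ω, Xi j ω)) ⁻¹' (Set.Iio (u' + ε) ×ˢ Set.Ioi (v' - ε)) with hB
  have hAm : MeasurableSet A := (hmi.prodMk hmj) (measurableSet_Ioi.prod measurableSet_Iio)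
  have hBm : MeasurableSet B := (hmi.prodMk hmj) (measurableSet_Iio.prod measurableSet_Ioi)
  have hAp : 0 < μ.real A := by
    refine ENNReal.toReal_pos (aux_supp_pos μ hmi hmj hx (isOpen_Ioi.prod isOpen_Iio) ?_).ne'
      (measure_ne_top _ _)
    exact ⟨by simp [hε0], by simp [hε0]⟩
  have hBp : 0 < μ.real B := by
    refine ENNReal.toReal_pos (aux_supp_pos μ hmi hmj hy (isOpen_Iio.prod isOpen_Ioi) ?_).ne'
      (measure_ne_top _ _)
    exact ⟨by simp [hε0], by simp [hε0]⟩
  set dA : ℝ := ε * μ.real B with hdA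
  set dB : ℝ := ε * μ.real A with hdB
  have hdA0 : 0 < dA := mul_pos hε0 hBp
  have hdB0 : 0 < dB := mul_pos hε0 hAp
  have hdA1 : dA ≤ ε := mul_le_of_le_one_right hε0.le measureReal_le_one
  have hdB1 : dB ≤ ε := mul_le_of_le_one_right hε0.le measureReal_le_one
  set D : Ω → ℝ := fun ω => A.indicator (fun _ => dA) ω - B.indicator (fun _ => dB) ω with hD
  have hDm : Measurable D := (measurable_const.indicator hAm).sub (measurable_const.indicator hBm)
  have iA : Integrable (A.indicator (fun _ => dA)) μ := (integrable_const _).indicator hAm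
  have iB : Integrable (B.indicator (fun _ => dB)) μ := (integrable_const _).indicator hBm
  have hDi : Integrable D μ := iA.sub iB
  have hD0 : ∫ ω, D ω ∂μ = 0 := by
    simp only [hD]
    rw [integral_sub iA iB, integral_indicator_const _ hAm, integral_indicator_const _ hBm]
    simp only [smul_eq_mul, hdA, hdB]; ring
  have hcase : ∀ ω, (D ω = dA ∧ u - ε < Xi i ω ∧ Xi j ω < v + ε) ∨
      (D ω = -dB ∧ Xi i ω < u' + ε ∧ v' - ε < Xi j ω) ∨ (D ω = 0 ∧ ω ∉ A) := by
    intro ω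
    by_cases hωA : ω ∈ A
    · have hA' : u - ε < Xi i ω ∧ Xi j ω < v + ε := by simpa [hA] using hωA
      have hωB : ω ∉ B := fun h => by
        have hB' : Xi i ω < u' + ε ∧ v' - ε < Xi j ω := by simpa [hB] using h
        linarith [hA'.1, hB'.1]
      left; exact ⟨by simp [hD, hωA, hωB], hA'⟩
    · by_cases hωB : ω ∈ B
      · have hB' : Xi i ω < u' + ε ∧ v' - ε < Xi j ω := by simpa [hB] using hωB
        right; left; exact ⟨by simp [hD, hωA, hωB], hB'⟩
      · right; right; exact ⟨by simp [hD, hωA, hωB], hωA⟩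
  have hDb : ∀ ω, |D ω| ≤ ε := fun ω => by
    rw [abs_le]
    rcases hcase ω with ⟨h, _⟩ | ⟨h, _⟩ | ⟨h, _⟩ <;> rw [h] <;> constructor <;> linarith
  set c : Fin p → ℝ := fun k => if k = i then -1 else if k = j then 1 else 0 with hc
  have hci : c i = -1 := by simp [hc]
  have hcj : c j = 1 := by simp [hc, Ne.symm hij]
  have hck : ∀ k, k ≠ i → k ≠ j → c k = 0 := fun k h1 h2 => by simp [hc, h1, h2]
  have hcs : ∑ k, c k = 0 := by
    have : ∀ k, c k = (if k = j then (1:ℝ) else 0) - (if k = i then 1 else 0) := fun k => by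
      by_cases h1 : k = i
      · subst h1; simp [hc, hij]
      · simp [hc, h1]
    simp [this]
  set Y : Fin p → Ω → ℝ := fun k ω => Xi k ω + c k * D ω with hY
  have hcb : ∀ k, |c k| ≤ 1 := fun k => by
    simp only [hc]; split_ifs <;> simp
  have hYa : IsAlloc X Y := by
    refine ⟨fun k => (hXi.1 k).add (hDm.const_mul _), fun k => ?_, fun ω => ?_⟩
    · obtain ⟨C, hC⟩ := hXi.2.1 k
      refine ⟨C + 1 * ε, fun ω => (abs_add_le _ _).trans (add_le_add (hC ω) ?_)⟩
      rw [abs_mul]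
      exact mul_le_mul (hcb k) (hDb ω) (abs_nonneg _) zero_le_one
    · simp only [hY]
      rw [Finset.sum_add_distrib, ← Finset.sum_mul, hcs, hXi.2.2]; ring
  have iX : ∀ k, Integrable (fun ω => Xi k ω) μ := fun k =>
    aux_int μ continuous_id (hXi.1 k) (hXi.2.1 k)
  have hmean : ∀ k, ∫ ω, Y k ω ∂μ = ∫ ω, Xi k ω ∂μ := fun k => by
    simp only [hY]
    rw [integral_add (iX k) (hDi.const_mul _), integral_const_mul, hD0]; ring
  refine heff ⟨Y, hYa, fun k => ?_, i, fun x => x ^ 2, ?_, ?_⟩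
  · by_cases hki : k = i
    · subst hki
      refine aux_transfer μ (hXi.1 k) (hXi.2.1 k) (hYa.1 k) (hYa.2.1 k) ((u + u') / 2) (hmean k) ?_
      intro ω
      simp only [hY, hci]
      rcases hcase ω with ⟨h, h1, h2⟩ | ⟨h, h1, h2⟩ | ⟨h, _⟩
      · left; rw [h]; constructor <;> linarith
      · right; left; rw [h]; constructor <;> linarith
      · right; right; rw [h]; ring
    by_cases hkj : k = j
    · subst hkj
      refine aux_transfer μ (hXi.1 k) (hXi.2.1 k) (hYa.1 k) (hYa.2.1 k) ((v + v') / 2) (hmean k) ?_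
      intro ω
      simp only [hY, hcj]
      rcases hcase ω with ⟨h, h1, h2⟩ | ⟨h, h1, h2⟩ | ⟨h, _⟩
      · right; left; rw [h]; constructor <;> linarith
      · left; rw [h]; constructor <;> linarith
      · right; right; rw [h]; ring
    · intro φ _
      simp [hY, hck k hki hkj]
  · exact even_two.convexOn_pow
  · have i1 := aux_int μ (continuous_pow 2) (hXi.1 i) (hXi.2.1 i)
    have i2 := aux_int μ (continuous_pow 2) (hYa.1 i) (hYa.2.1 i)
    set G : Ω → ℝ := fun ω => Xi i ω ^ 2 - (u + u') * D ω with hG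
    have iG : Integrable G μ := i1.sub (hDi.const_mul _)
    have iA' : Integrable (A.indicator (fun _ => dA * ε)) μ := (integrable_const _).indicator hAm
    have key : ∫ ω, Y i ω ^ 2 ∂μ ≤ ∫ ω, (G ω - A.indicator (fun _ => dA * ε) ω) ∂μ := by
      refine integral_mono i2 (iG.sub iA') fun ω => ?_
      simp only [hY, hci, hG]
      rcases hcase ω with ⟨h, h1, h2⟩ | ⟨h, h1, h2⟩ | ⟨h, h1⟩
      · have : A.indicator (fun _ => dA * ε) ω ≤ dA * ε :=
          Set.indicator_le_self' (fun _ _ => by positivity) ω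
        rw [h]
        nlinarith
      · have hωA : ω ∉ A := fun hω => by
          have hA' : u - ε < Xi i ω ∧ Xi j ω < v + ε := by simpa [hA] using hω
          linarith [hA'.1]
        rw [h, Set.indicator_of_notMem hωA]
        nlinarith
      · rw [h, Set.indicator_of_notMem h1]; simp
    rw [integral_sub iG iA', integral_indicator_const _ hAm] at key
    have eG : ∫ ω, G ω ∂μ = ∫ ω, Xi i ω ^ 2 ∂μ := by
      simp only [hG]
      rw [integral_sub i1 (hDi.const_mul _), integral_const_mul, hD0]; ring
    have : 0 < μ.real A • (dA * ε) := by simp only [smul_eq_mul]; positivity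
    simp only at *
    linarith

/-- efficiency ⇔ comonotonicity ⇔ minimization of a strictly
convex expected-cost risk-sharing problem. -/
theorem stmt13 {Ω : Type*} [MeasurableSpace Ω] (μ : Measure Ω) [IsProbabilityMeasure μ]
    (hna : Nonatomic μ) {p : ℕ} (hp : 0 < p)
    (X : Ω → ℝ) (hXm : Measurable X) (hXb : ∃ C, ∀ ω, |X ω| ≤ C)
    (Xi : Fin p → Ω → ℝ) (hXi : IsAlloc X Xi) :
    (EfficientAlloc μ X Xi ↔ ∀ i j, Comonotone μ (Xi i) (Xi j)) ∧
    ((∀ i j, Comonotone μ (Xi i) (Xi j)) ↔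
      ∃ ψ : Fin p → ℝ → ℝ,
        (∀ i, Continuous (ψ i) ∧ StrictConvexOn ℝ Set.univ (ψ i)) ∧
        ∀ Y : Fin p → Ω → ℝ, IsAlloc X Y →
          ∫ ω, ∑ i, ψ i (Xi i ω) ∂μ ≤ ∫ ω, ∑ i, ψ i (Y i ω) ∂μ) := by
  have h1 := aux_min_of_comon μ X Xi hXi
  have h3 := aux_comon_of_eff μ X Xi hXi
  refine ⟨⟨h3, fun hc => ?_⟩, ⟨h1, ?_⟩⟩
  · obtain ⟨ψ, hψ, hmin⟩ := h1 hc
    exact aux_eff_of_min μ X Xi hXi ψ hψ hmin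
  · rintro ⟨ψ, hψ, hmin⟩
    exact h3 (aux_eff_of_min μ X Xi hXi ψ hψ hmin)
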